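/- arXiv:1604.07129 — 5 statements merged into one kernel-verified Lean document; each statement's English description precedes it below -/
import Mathlib

section
/- Let d and ρ be two locally Lipschitz equivalent metrics on a set M, and let Y ⊆ M be a compact subset. Then d and ρ are Lipschitz equivalent on Y: there exist constants 0 < c ≤ C such that c·d(x,y) ≤ ρ(x,y) ≤ C·d(x,y) for all x,y ∈ Y. -/
/-- Two metrics on the same set are *locally Lipschitz equivalent* if they induce the
same topology and around every point they are Lipschitz comparable. -/
def LocLipEquiv {M : Type*} (d ρ : MetricSpace M) : Prop :=
  d.toUniformSpace.toTopologicalSpace = ρ.toUniformSpace.toTopologicalSpace ∧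
  ∀ p : M, ∃ V ∈ @nhds M d.toUniformSpace.toTopologicalSpace p, ∃ c C : ℝ,
    0 < c ∧ c ≤ C ∧ ∀ x ∈ V, ∀ y ∈ V,
      c * d.dist x y ≤ ρ.dist x y ∧ ρ.dist x y ≤ C * d.dist x y

open Filter Topology in
/-- A continuous function on `M × M` that is bounded by a multiple of a nonnegative continuous
function near every point of the diagonal, the latter being positive off the diagonal, is bounded
by a multiple of it on the square of every compact set. -/
theorem IsCompact.exists_forall_le_mul_of_locally {M : Type*} [TopologicalSpace M]
    {f g : M × M → ℝ} (hf : Continuous f) (hg : Continuous g) (hg_nonneg : ∀ z, 0 ≤ g z)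
    (hg_pos : ∀ x y, x ≠ y → 0 < g (x, y))
    (hloc : ∀ p : M, ∃ V ∈ 𝓝 p, ∃ C : ℝ, ∀ x ∈ V, ∀ y ∈ V, f (x, y) ≤ C * g (x, y))
    {Y : Set M} (hY : IsCompact Y) :
    ∃ C : ℝ, 1 ≤ C ∧ ∀ x ∈ Y, ∀ y ∈ Y, f (x, y) ≤ C * g (x, y) := by
  have key : ∃ C : ℝ, ∀ z ∈ Y ×ˢ Y, f z ≤ C * g z := by
    refine (hY.prod hY).induction_on (p := fun S ↦ ∃ C : ℝ, ∀ z ∈ S, f z ≤ C * g z)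
      ⟨0, by simp⟩ (fun s t hst ⟨C, hC⟩ ↦ ⟨C, fun z hz ↦ hC z (hst hz)⟩) ?_ ?_
    · rintro s t ⟨C, hC⟩ ⟨D, hD⟩
      refine ⟨max C D, ?_⟩
      rintro z (hz | hz)
      · exact (hC z hz).trans (mul_le_mul_of_nonneg_right (le_max_left _ _) (hg_nonneg z))
      · exact (hD z hz).trans (mul_le_mul_of_nonneg_right (le_max_right _ _) (hg_nonneg z))
    · rintro ⟨x, y⟩ -
      by_cases hxy : x = y
      · subst hxy
        obtain ⟨V, hV, C, hC⟩ := hloc x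
        exact ⟨V ×ˢ V, mem_nhdsWithin_of_mem_nhds (prod_mem_nhds hV hV), C,
          fun z hz ↦ hC z.1 hz.1 z.2 hz.2⟩
      · have hpos := hg_pos x y hxy
        have hlt : f (x, y) < (f (x, y) / g (x, y) + 1) * g (x, y) := by
          rw [add_mul, div_mul_cancel₀ _ hpos.ne']
          linarith
        refine ⟨{z | f z < (f (x, y) / g (x, y) + 1) * g z}, mem_nhdsWithin_of_mem_nhds ?_,
          f (x, y) / g (x, y) + 1, fun z hz ↦ le_of_lt hz⟩
        exact (isOpen_lt hf (continuous_const.mul hg)).mem_nhds hlt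
  obtain ⟨C, hC⟩ := key
  exact ⟨max 1 C, le_max_left _ _, fun x hx y hy ↦ (hC (x, y) ⟨hx, hy⟩).trans
    (mul_le_mul_of_nonneg_right (le_max_right _ _) (hg_nonneg _))⟩

/-- Two locally Lipschitz equivalent metrics are (globally) Lipschitz
equivalent on every compact subset. -/
theorem stmt6 {M : Type*} (d ρ : MetricSpace M) (h : LocLipEquiv d ρ)
    {Y : Set M} (hY : @IsCompact M d.toUniformSpace.toTopologicalSpace Y) :
    ∃ c C : ℝ, 0 < c ∧ c ≤ C ∧ ∀ x ∈ Y, ∀ y ∈ Y,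
      c * d.dist x y ≤ ρ.dist x y ∧ ρ.dist x y ≤ C * d.dist x y := by
  obtain ⟨htop, hloc⟩ := h
  let _ : TopologicalSpace M := d.toUniformSpace.toTopologicalSpace
  have hd : Continuous fun z : M × M ↦ d.dist z.1 z.2 := @continuous_dist M d.toPseudoMetricSpace
  have hρ : Continuous fun z : M × M ↦ ρ.dist z.1 z.2 := by
    have hcont := @continuous_dist M ρ.toPseudoMetricSpace
    rwa [← htop] at hcont
  obtain ⟨C, hC_one, hC⟩ := hY.exists_forall_le_mul_of_locally hρ hd
    (fun z ↦ @dist_nonneg M d.toPseudoMetricSpace z.1 z.2)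
    (fun x y hxy ↦ (@dist_pos M d x y).2 hxy)
    (fun p ↦ by
      obtain ⟨V, hV, c, C, -, -, hVC⟩ := hloc p
      exact ⟨V, hV, C, fun x hx y hy ↦ (hVC x hx y hy).2⟩)
  obtain ⟨D, hD_one, hD⟩ := hY.exists_forall_le_mul_of_locally hd hρ
    (fun z ↦ @dist_nonneg M ρ.toPseudoMetricSpace z.1 z.2)
    (fun x y hxy ↦ (@dist_pos M ρ x y).2 hxy)
    (fun p ↦ by
      obtain ⟨V, hV, c, C, hc, -, hVC⟩ := hloc p
      exact ⟨V, hV, c⁻¹, fun x hx y hy ↦ (le_inv_mul_iff₀ hc).2 (hVC x hx y hy).1⟩)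
  have hD_pos : 0 < D := zero_lt_one.trans_le hD_one
  exact ⟨D⁻¹, C, inv_pos.2 hD_pos, (inv_le_one_of_one_le₀ hD_one).trans hC_one,
    fun x hx y hy ↦ ⟨(inv_mul_le_iff₀ hD_pos).2 (hD x hx y hy), hC x hx y hy⟩⟩
end

section
/- Let a group G act by isometries on a metric space (M,d), let X ⊆ M be a nonempty compact subset, and let c : ℝ → G satisfy c(s+t) = c(s)·c(t) for all s,t ∈ ℝ (a one-parameter subgroup; in the paper c(t) = exp(tv) for v in the Lie algebra of a Lie group). For a ≤ b define L(a,b) := sup over all partitions a=t₀<…<tₙ=b of Σᵢ d_H(c(tᵢ)•X, c(tᵢ₋₁)•X), the length (total variation) of the curve t ↦ c(t)•X in the Hausdorff metric over [a,b], with values in [0,∞]. Then L(a,b) = (b−a)·L(0,1) for all a ≤ b. -/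
open Pointwise

open scoped NNReal ENNReal

/-- An additive map `ℝ≥0 → ℝ≥0∞` is monotone. -/
theorem AddMonoidHom.monotone_nnreal_ennreal (F : ℝ≥0 →+ ℝ≥0∞) : Monotone F := by
  intro x y h
  obtain ⟨z, rfl⟩ := exists_add_of_le h
  rw [map_add]
  exact le_self_add

/-- An additive map `ℝ≥0 → ℝ≥0∞` is linear. -/
theorem AddMonoidHom.nnreal_ennreal_apply (F : ℝ≥0 →+ ℝ≥0∞) (t : ℝ≥0) :
    F t = t * F 1 := by
  have mono := F.monotone_nnreal_ennreal
  have hmul (n : ℕ) (x : ℝ≥0) : F (n * x) = n * F x := by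
    simpa only [nsmul_eq_mul] using map_nsmul F n x
  have hnat (n : ℕ) : F n = n * F 1 := by simpa using hmul n 1
  rcases eq_or_ne t 0 with rfl | ht
  · simp
  by_cases h1 : F 1 = ∞
  · obtain ⟨n, hn⟩ := exists_nat_ge t⁻¹
    have hnt : 1 ≤ n * t := by
      simpa [ht] using mul_le_mul_left hn t
    have htop : (n : ℝ≥0∞) * F t = ∞ := by
      rw [← hmul, ← top_le_iff, ← h1]
      exact mono hnt
    have hFt : F t = ∞ := by
      by_contra h
      exact ENNReal.mul_ne_top (ENNReal.natCast_ne_top n) h htop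
    rw [hFt, h1, ENNReal.mul_top (by simpa using ht)]
  have hfin (x : ℝ≥0) : F x ≠ ∞ := by
    obtain ⟨n, hn⟩ := exists_nat_ge x
    refine ne_top_of_le_ne_top ?_ (mono hn)
    rw [hnat]
    exact ENNReal.mul_ne_top (ENNReal.natCast_ne_top n) h1
  have key (n : ℕ) : |(n : ℝ) * ((F t).toReal - t * (F 1).toReal)| ≤ (F 1).toReal := by
    have hl := ENNReal.toReal_mono (hfin _) (mono (Nat.floor_le (zero_le (a := n * t))))
    have hu := ENNReal.toReal_mono (hfin _) (mono (Nat.lt_floor_add_one (n * t)).le)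
    rw [map_add, ENNReal.toReal_add (hfin _) (hfin _)] at hu
    simp only [hnat, hmul, ENNReal.toReal_mul, ENNReal.toReal_natCast] at hl hu
    have hl' : ((⌊n * t⌋₊ : ℝ≥0) : ℝ) ≤ n * t := by
      exact_mod_cast Nat.floor_le (zero_le (a := n * t))
    have hu' : (n * t : ℝ) ≤ (⌊n * t⌋₊ : ℝ≥0) + 1 := by
      exact_mod_cast (Nat.lt_floor_add_one (n * t)).le
    simp only [NNReal.coe_natCast] at hl' hu'
    have h0 : 0 ≤ (F 1).toReal := ENNReal.toReal_nonneg
    rw [abs_le]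
    constructor <;> nlinarith [mul_le_mul_of_nonneg_right hl' h0,
      mul_le_mul_of_nonneg_right hu' h0]
  have heq : (F t).toReal - t * (F 1).toReal = 0 := by
    by_contra h
    obtain ⟨n, hn⟩ := exists_nat_gt ((F 1).toReal / |(F t).toReal - t * (F 1).toReal|)
    rw [div_lt_iff₀ (abs_pos.mpr h)] at hn
    have := key n
    rw [abs_mul, Nat.abs_cast] at this
    exact hn.not_ge this
  rw [← ENNReal.toReal_eq_toReal_iff' (hfin t) (ENNReal.mul_ne_top ENNReal.coe_ne_top h1),
    ENNReal.toReal_mul, ENNReal.coe_toReal]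
  linarith

section TranslationInvariant

variable {E : Type*} [PseudoEMetricSpace E] {f : ℝ → E}

/-- The variation of a curve with translation-invariant distances is translation invariant. -/
theorem eVariationOn_Icc_add_left
    (hf : ∀ s x y : ℝ, edist (f (s + x)) (f (s + y)) = edist (f x) (f y)) (s a b : ℝ) :
    eVariationOn f (Set.Icc (s + a) (s + b)) = eVariationOn f (Set.Icc a b) := by
  rw [← Set.image_const_add_Icc, ← eVariationOn.comp_eq_of_monotoneOn f (fun x => s + x)
    (fun x _ y _ h => by simpa using h)]
  simp only [eVariationOn, Function.comp_apply, hf]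

/-- A curve with translation-invariant distances has variation proportional to the length of
the parameter interval. -/
theorem eVariationOn_Icc_eq_ofReal_mul
    (hf : ∀ s x y : ℝ, edist (f (s + x)) (f (s + y)) = edist (f x) (f y))
    {a b : ℝ} (hab : a ≤ b) :
    eVariationOn f (Set.Icc a b) =
      ENNReal.ofReal (b - a) * eVariationOn f (Set.Icc 0 1) := by
  let F : ℝ≥0 →+ ℝ≥0∞ :=
    { toFun := fun t => eVariationOn f (Set.Icc 0 (t : ℝ))
      map_zero' := eVariationOn.subsingleton f (by simp)
      map_add' := fun x y => by
        have h := eVariationOn.Icc_add_Icc f (s := Set.univ) x.coe_nonneg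
          (le_add_of_nonneg_right (a := (x : ℝ)) y.coe_nonneg) (Set.mem_univ _)
        have hy := eVariationOn_Icc_add_left hf x 0 y
        rw [add_zero] at hy
        simp only [Set.univ_inter] at h
        rw [NNReal.coe_add, ← h, hy] }
  have h := F.nnreal_ennreal_apply (b - a).toNNReal
  have hF : F (b - a).toNNReal = eVariationOn f (Set.Icc 0 (b - a)) := by
    change eVariationOn f (Set.Icc 0 ((b - a).toNNReal : ℝ)) = _
    rw [Real.coe_toNNReal _ (sub_nonneg.mpr hab)]
  have hF1 : F 1 = eVariationOn f (Set.Icc 0 1) := by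
    change eVariationOn f (Set.Icc 0 ((1 : ℝ≥0) : ℝ)) = _
    rw [NNReal.coe_one]
  rw [hF, hF1] at h
  have ht := eVariationOn_Icc_add_left hf a 0 (b - a)
  rw [add_zero, add_sub_cancel] at ht
  exact ht.trans h

end TranslationInvariant

/-- Let a group `G` act by isometries on a metric space `M`, let `X` be a
nonempty compact subset, and let `c : ℝ → G` be a one-parameter subgroup.  Let
`γ(t) = c(t) • X`, viewed as a curve in the space of nonempty compact subsets of `M` with
the Hausdorff distance.  Then the length `L(a,b)` of `γ` over `[a,b]` satisfies
`L(a,b) = (b-a) · L(0,1)` for all `a ≤ b`. -/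
theorem stmt11 {G M : Type*} [Group G] [MetricSpace M] [MulAction G M]
    (hiso : ∀ (g : G) (x y : M), dist (g • x) (g • y) = dist x y)
    (X : TopologicalSpace.NonemptyCompacts M)
    (c : ℝ → G) (hc : ∀ s t : ℝ, c (s + t) = c s * c t)
    (γ : ℝ → TopologicalSpace.NonemptyCompacts M)
    (hγ : ∀ t : ℝ, (γ t : Set M) = c t • (X : Set M))
    (a b : ℝ) (hab : a ≤ b) :
    eVariationOn γ (Set.Icc a b) =
      ENNReal.ofReal (b - a) * eVariationOn γ (Set.Icc 0 1) := by
  refine eVariationOn_Icc_eq_ofReal_mul (fun s x y => ?_) hab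
  have himage (t : ℝ) : (γ (s + t) : Set M) = (c s • ·) '' (γ t : Set M) := by
    rw [hγ, hγ, hc, mul_smul]
    rfl
  have hs : Isometry (c s • · : M → M) := Isometry.of_dist_eq (hiso (c s))
  change Metric.hausdorffEDist (γ (s + x) : Set M) (γ (s + y)) =
    Metric.hausdorffEDist (γ x : Set M) (γ y)
  rw [himage, himage, Metric.hausdorffEDist_image hs]
end

section
/- Let a group G act by isometries on a metric space (M,d), let X ⊆ M be a nonempty compact subset, and let c : ℝ → G satisfy c(s+t) = c(s)·c(t) for all s,t ∈ ℝ (a one-parameter subgroup; in the paper c(t) = exp(tv) for v in the Lie algebra of a Lie group). Let γ(t) := c(t)•X, regarded as a curve in the space of nonempty compact subsets of M with the Hausdorff distance d_H, and suppose the length ℓ of γ restricted to [0,1] is finite. Then the speed of γ at 0 exists and equals ℓ: lim_{t→0} d_H(c(t)•X, X)/|t| = ℓ. -/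
open Pointwise

section HomogeneousCurve

variable {E : Type*} [PseudoMetricSpace E] {γ : ℝ → E}

lemma dist_nat_mul_add_le (h : ∀ s t : ℝ, dist (γ (s + t)) (γ s) = dist (γ t) (γ 0))
    (n : ℕ) (t s : ℝ) :
    dist (γ (n * t + s)) (γ 0) ≤ n * dist (γ t) (γ 0) + dist (γ s) (γ 0) := by
  induction n with
  | zero => simp
  | succ n ih =>
    have h1 := dist_triangle (γ ((n * t + s) + t)) (γ (n * t + s)) (γ 0)
    rw [h (n * t + s) t] at h1
    have h2 : ((n + 1 : ℕ) : ℝ) * t + s = (n * t + s) + t := by push_cast; ring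
    rw [h2]
    push_cast
    linarith

lemma nat_mul_dist_le_eVariationOn
    (h : ∀ s t : ℝ, dist (γ (s + t)) (γ s) = dist (γ t) (γ 0))
    (hfin : eVariationOn γ (Set.Icc 0 1) ≠ ⊤) {n : ℕ} {t : ℝ} (ht : 0 ≤ t) (hn : n * t ≤ 1) :
    n * dist (γ t) (γ 0) ≤ (eVariationOn γ (Set.Icc 0 1)).toReal := by
  have key := eVariationOn.sum_le_of_monotoneOn_Icc (f := γ) (s := Set.Icc 0 1) (m := 0) (n := n)
    (u := fun i : ℕ => (i : ℝ) * t)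
    (fun i _ j _ hij => mul_le_mul_of_nonneg_right (by exact_mod_cast hij) ht)
    (fun i hi => ⟨by positivity, le_trans
      (mul_le_mul_of_nonneg_right (by exact_mod_cast hi.2) ht) hn⟩)
  have h2 : ∀ i ∈ Finset.Ico 0 n, edist (γ (((i + 1 : ℕ) : ℝ) * t)) (γ ((i : ℝ) * t))
      = edist (γ t) (γ 0) := by
    intro i _
    rw [edist_dist, edist_dist, ← h (i * t) t]
    congr 4
    push_cast
    ring
  rw [Finset.sum_congr rfl h2] at key
  have h3 := ENNReal.toReal_mono hfin key
  simpa [dist_edist] using h3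

lemma dist_le_eVariationOn_mul_div
    (h : ∀ s t : ℝ, dist (γ (s + t)) (γ s) = dist (γ t) (γ 0))
    (hfin : eVariationOn γ (Set.Icc 0 1) ≠ ⊤) {t : ℝ} (ht : 0 < t) (ht1 : t < 1) :
    dist (γ t) (γ 0) / t ≤ (eVariationOn γ (Set.Icc 0 1)).toReal / (1 - t) := by
  have h1 := Nat.floor_le (a := 1 / t) (by positivity)
  have h2 := Nat.lt_floor_add_one (1 / t)
  rw [le_div_iff₀ ht] at h1
  rw [div_lt_iff₀ ht] at h2
  have h3 := nat_mul_dist_le_eVariationOn h hfin ht.le h1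
  rw [div_le_div_iff₀ ht (by linarith)]
  have h4 : dist (γ t) (γ 0) * (1 - t) ≤ dist (γ t) (γ 0) * (⌊1 / t⌋₊ * t) :=
    mul_le_mul_of_nonneg_left (by linarith) dist_nonneg
  nlinarith

lemma exists_mul_lt_dist
    (h : ∀ s t : ℝ, dist (γ (s + t)) (γ s) = dist (γ t) (γ 0)) {r : ℝ}
    (hr : r < (eVariationOn γ (Set.Icc 0 1)).toReal) :
    ∃ d > 0, r * d < dist (γ d) (γ 0) := by
  by_contra! hcon
  have hr0 : 0 ≤ r := by simpa using dist_nonneg.trans (hcon 1 one_pos)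
  have hle : eVariationOn γ (Set.Icc 0 1) ≤ ENNReal.ofReal r := by
    refine iSup_le ?_
    rintro ⟨n, u, hu, us⟩
    have h1 : ∀ i ∈ Finset.range n, edist (γ (u (i + 1))) (γ (u i)) ≤
        ENNReal.ofReal (r * (u (i + 1) - u i)) := by
      intro i _
      have hui : u i ≤ u (i + 1) := hu (Nat.le_succ i)
      rw [edist_dist]
      refine ENNReal.ofReal_le_ofReal ?_
      rcases hui.eq_or_lt with heq | hlt
      · simp [← heq]
      · have h2 := h (u i) (u (i + 1) - u i)
        rw [add_sub_cancel] at h2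
        rw [h2]
        exact hcon _ (sub_pos.2 hlt)
    refine (Finset.sum_le_sum h1).trans ?_
    rw [← ENNReal.ofReal_sum_of_nonneg
      (fun i _ => mul_nonneg hr0 (sub_nonneg.2 (hu (Nat.le_succ i)))),
      ← Finset.mul_sum, Finset.sum_range_sub]
    refine ENNReal.ofReal_le_ofReal ?_
    have := (us n).2
    have := (us 0).1
    nlinarith
  exact absurd (ENNReal.toReal_le_of_le_ofReal hr0 hle) (not_le.2 hr)

lemma dist_sub_div_le_dist_div
    (h : ∀ s t : ℝ, dist (γ (s + t)) (γ s) = dist (γ t) (γ 0))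
    (hfin : eVariationOn γ (Set.Icc 0 1) ≠ ⊤) {d t : ℝ} (hd : 0 < d) (ht : 0 < t)
    (ht1 : t < 1 / 2) :
    (dist (γ d) (γ 0) - 2 * (eVariationOn γ (Set.Icc 0 1)).toReal * t) / d
      ≤ dist (γ t) (γ 0) / t := by
  have hL : 0 ≤ (eVariationOn γ (Set.Icc 0 1)).toReal := ENNReal.toReal_nonneg
  have h1 := Nat.floor_le (a := d / t) (by positivity)
  have h2 := Nat.lt_floor_add_one (d / t)
  rw [le_div_iff₀ ht] at h1
  rw [div_lt_iff₀ ht] at h2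
  have h3 := dist_nat_mul_add_le h ⌊d / t⌋₊ t (d - ⌊d / t⌋₊ * t)
  rw [add_sub_cancel] at h3
  set n : ℝ := (⌊d / t⌋₊ : ℝ)
  have hrem : dist (γ (d - n * t)) (γ 0) ≤
      2 * (eVariationOn γ (Set.Icc 0 1)).toReal * t := by
    rcases h1.eq_or_lt with heq | hlt
    · rw [heq, sub_self, dist_self]
      positivity
    · have h4 := dist_le_eVariationOn_mul_div h hfin (sub_pos.2 hlt) (by linarith)
      rw [div_le_div_iff₀ (by linarith) (by linarith)] at h4
      have h5 : (eVariationOn γ (Set.Icc 0 1)).toReal * (d - n * t) ≤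
        (eVariationOn γ (Set.Icc 0 1)).toReal * t := mul_le_mul_of_nonneg_left (by linarith) hL
      have h6 : dist (γ (d - n * t)) (γ 0) * (1 / 2) ≤
        dist (γ (d - n * t)) (γ 0) * (1 - (d - n * t)) :=
          mul_le_mul_of_nonneg_left (by linarith) dist_nonneg
      linarith
  rw [div_le_div_iff₀ hd ht]
  have h7 : dist (γ t) (γ 0) * (n * t) ≤ dist (γ t) (γ 0) * d :=
    mul_le_mul_of_nonneg_left h1 dist_nonneg
  have h8 : (dist (γ d) (γ 0) - 2 * (eVariationOn γ (Set.Icc 0 1)).toReal * t) * t ≤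
    (n * dist (γ t) (γ 0)) * t := mul_le_mul_of_nonneg_right (by linarith) ht.le
  linarith

lemma tendsto_dist_div_nhdsGT
    (h : ∀ s t : ℝ, dist (γ (s + t)) (γ s) = dist (γ t) (γ 0))
    (hfin : eVariationOn γ (Set.Icc 0 1) ≠ ⊤) :
    Filter.Tendsto (fun t : ℝ => dist (γ t) (γ 0) / t) (nhdsWithin 0 (Set.Ioi 0))
      (nhds (eVariationOn γ (Set.Icc 0 1)).toReal) := by
  set L := (eVariationOn γ (Set.Icc 0 1)).toReal with hL
  have hpos : ∀ᶠ t : ℝ in nhdsWithin 0 (Set.Ioi 0), t ∈ Set.Ioo (0 : ℝ) (1 / 2) :=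
    Ioo_mem_nhdsGT (by norm_num)
  refine tendsto_order.2 ⟨fun r hr => ?_, fun r hr => ?_⟩
  · obtain ⟨d, hd, hrd⟩ := exists_mul_lt_dist h hr
    have hlim : Filter.Tendsto (fun t : ℝ => (dist (γ d) (γ 0) - 2 * L * t) / d)
        (nhdsWithin 0 (Set.Ioi 0)) (nhds ((dist (γ d) (γ 0) - 2 * L * 0) / d)) :=
      Continuous.continuousWithinAt (by fun_prop)
    have hev := hlim.eventually_const_lt (u := r) (by
      rw [mul_zero, sub_zero, lt_div_iff₀ hd]; exact hrd)
    filter_upwards [hev, hpos] with t h1 h2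
    exact h1.trans_le (dist_sub_div_le_dist_div h hfin hd h2.1 h2.2)
  · have hlim : Filter.Tendsto (fun t : ℝ => L / (1 - t))
        (nhdsWithin 0 (Set.Ioi 0)) (nhds (L / (1 - 0))) :=
      ContinuousAt.continuousWithinAt
        (continuousAt_const.div (by fun_prop) (by norm_num))
    have hev := hlim.eventually_lt_const (u := r) (by simpa using hr)
    filter_upwards [hev, hpos] with t h1 h2
    exact (dist_le_eVariationOn_mul_div h hfin h2.1 (by linarith [h2.2])).trans_lt h1

/-- A curve on which translations act by isometries and whose length over `[0, 1]` is finite has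
speed at `0` equal to this length. -/
lemma tendsto_dist_div_abs
    (h : ∀ s t : ℝ, dist (γ (s + t)) (γ s) = dist (γ t) (γ 0))
    (hfin : eVariationOn γ (Set.Icc 0 1) ≠ ⊤) :
    Filter.Tendsto (fun t : ℝ => dist (γ t) (γ 0) / |t|) (nhdsWithin 0 {(0 : ℝ)}ᶜ)
      (nhds (eVariationOn γ (Set.Icc 0 1)).toReal) := by
  have habs : Filter.Tendsto (fun t : ℝ => |t|) (nhdsWithin 0 {(0 : ℝ)}ᶜ)
      (nhdsWithin 0 (Set.Ioi 0)) := by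
    refine tendsto_nhdsWithin_iff.2 ⟨?_, ?_⟩
    · have : Filter.Tendsto (fun t : ℝ => |t|) (nhds 0) (nhds |0|) := continuous_abs.tendsto 0
      rw [abs_zero] at this
      exact this.mono_left nhdsWithin_le_nhds
    · filter_upwards [self_mem_nhdsWithin] with t ht
      exact abs_pos.2 ht
  refine ((tendsto_dist_div_nhdsGT h hfin).comp habs).congr fun t => ?_
  rcases abs_choice t with ht | ht
  · simp [ht]
  · have h1 := h t (-t)
    rw [add_neg_cancel, dist_comm] at h1
    simp [ht, h1]

end HomogeneousCurve

/-- Let a group `G` act by isometries on a metric space `M`, let `X` be a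
nonempty compact subset, and let `c : ℝ → G` be a one-parameter subgroup.  Let
`γ(t) = c(t) • X`, viewed as a curve in the space of nonempty compact subsets of `M` with
the Hausdorff distance, and suppose the length `ℓ` of `γ` over `[0,1]` is finite.  Then
the speed of `γ` at `0` exists and equals `ℓ`:
`lim_{t→0, t≠0} d_H(c(t) • X, X)/|t| = ℓ`. -/
theorem stmt12 {G M : Type*} [Group G] [MetricSpace M] [MulAction G M]
    (hiso : ∀ (g : G) (x y : M), dist (g • x) (g • y) = dist x y)
    (X : TopologicalSpace.NonemptyCompacts M)
    (c : ℝ → G) (hc : ∀ s t : ℝ, c (s + t) = c s * c t)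
    (γ : ℝ → TopologicalSpace.NonemptyCompacts M)
    (hγ : ∀ t : ℝ, (γ t : Set M) = c t • (X : Set M))
    (hfin : eVariationOn γ (Set.Icc 0 1) ≠ ⊤) :
    Filter.Tendsto (fun t : ℝ => dist (γ t) X / |t|)
      (nhdsWithin 0 {(0 : ℝ)}ᶜ)
      (nhds (eVariationOn γ (Set.Icc 0 1)).toReal) := by
  have hc0 : c 0 = 1 := by simpa using hc 0 0
  have hX : γ 0 = X := SetLike.coe_injective (by rw [hγ, hc0, one_smul])
  have h : ∀ s t : ℝ, dist (γ (s + t)) (γ s) = dist (γ t) (γ 0) := by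
    intro s t
    have hisom : Isometry (fun x : M => c s • x) := Isometry.of_dist_eq (hiso (c s))
    have h1 : (γ (s + t) : Set M) = (fun x : M => c s • x) '' (γ t : Set M) := by
      rw [hγ, hγ, hc, mul_smul]
      rfl
    have h2 : (γ s : Set M) = (fun x : M => c s • x) '' (γ 0 : Set M) := by
      rw [hX, hγ]
      rfl
    rw [Metric.NonemptyCompacts.dist_eq, Metric.NonemptyCompacts.dist_eq, h1, h2,
      Metric.hausdorffDist_image hisom]
  rw [← hX]
  exact tendsto_dist_div_abs h hfin
end

section
/- Let E be a real normed vector space, let p ∈ E, and let d be a metric on E for which there exist a norm-neighborhood V of p and constants 0 < c ≤ C with c·‖x−y‖ ≤ d(x,y) ≤ C·‖x−y‖ for all x,y ∈ V. Let c₁, c₂ : (−ε,ε) → E be curves with c₁(0) = c₂(0) = p that are differentiable at 0 with c₁′(0) = c₂′(0). If the limit lim_{t→0} d(c₁(t), p)/|t| exists and equals L, then lim_{t→0} d(c₂(t), p)/|t| = L. -/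
/-- Two curves with the same value and the same derivative at `0` agree to first order. -/
theorem HasDerivAt.tendsto_norm_sub_div_abs {E : Type*} [NormedAddCommGroup E] [NormedSpace ℝ E]
    {c₁ c₂ : ℝ → E} {v : E} (h₁ : HasDerivAt c₁ v 0) (h₂ : HasDerivAt c₂ v 0)
    (h : c₁ 0 = c₂ 0) :
    Filter.Tendsto (fun t : ℝ => ‖c₂ t - c₁ t‖ / |t|) (nhdsWithin 0 {(0 : ℝ)}ᶜ) (nhds 0) := by
  have key := (hasDerivAt_iff_tendsto_slope_zero.mp (h₂.sub h₁)).norm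
  simpa [h, norm_smul, div_eq_inv_mul] using key


/-- Let `E` be a real normed vector space, `p ∈ E`, and let `d` be a metric
on `E` Lipschitz equivalent to the norm metric on a neighborhood `V` of `p`.  If two curves
`c₁, c₂` through `p` have the same derivative at `0`, and the speed
`lim_{t→0} d(c₁(t),p)/|t|` exists and equals `L`, then also
`lim_{t→0} d(c₂(t),p)/|t| = L`. -/
theorem stmt13 {E : Type*} [NormedAddCommGroup E] [NormedSpace ℝ E]
    (p : E) (dm : MetricSpace E)
    (V : Set E) (hV : V ∈ nhds p) (c C : ℝ) (hc : 0 < c) (hcC : c ≤ C)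
    (hlow : ∀ x ∈ V, ∀ y ∈ V, c * ‖x - y‖ ≤ dm.dist x y)
    (hup : ∀ x ∈ V, ∀ y ∈ V, dm.dist x y ≤ C * ‖x - y‖)
    (ε : ℝ) (hε : 0 < ε)
    (c₁ c₂ : ℝ → E) (h₁0 : c₁ 0 = p) (h₂0 : c₂ 0 = p)
    (v : E) (h₁d : HasDerivAt c₁ v 0) (h₂d : HasDerivAt c₂ v 0)
    (L : ℝ)
    (hL : Filter.Tendsto (fun t : ℝ => dm.dist (c₁ t) p / |t|)
      (nhdsWithin 0 {(0 : ℝ)}ᶜ) (nhds L)) :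
    Filter.Tendsto (fun t : ℝ => dm.dist (c₂ t) p / |t|)
      (nhdsWithin 0 {(0 : ℝ)}ᶜ) (nhds L) := by
  have hnorm : Filter.Tendsto (fun t : ℝ => C * (‖c₂ t - c₁ t‖ / |t|))
      (nhdsWithin 0 {(0 : ℝ)}ᶜ) (nhds 0) := by
    simpa using (h₁d.tendsto_norm_sub_div_abs h₂d (h₁0.trans h₂0.symm)).const_mul C
  have hV₁ : ∀ᶠ t in nhdsWithin 0 {(0 : ℝ)}ᶜ, c₁ t ∈ V :=
    (h₁d.continuousAt.eventually_mem (h₁0.symm ▸ hV)).filter_mono nhdsWithin_le_nhds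
  have hV₂ : ∀ᶠ t in nhdsWithin 0 {(0 : ℝ)}ᶜ, c₂ t ∈ V :=
    (h₂d.continuousAt.eventually_mem (h₂0.symm ▸ hV)).filter_mono nhdsWithin_le_nhds
  have hdiff : Filter.Tendsto (fun t : ℝ => dm.dist (c₂ t) p / |t| - dm.dist (c₁ t) p / |t|)
      (nhdsWithin 0 {(0 : ℝ)}ᶜ) (nhds 0) := by
    refine squeeze_zero_norm' ?_ hnorm
    filter_upwards [hV₁, hV₂] with t ht₁ ht₂
    rw [← sub_div, Real.norm_eq_abs, abs_div, abs_abs, ← mul_div_assoc]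
    gcongr
    exact (@abs_dist_sub_le E dm.toPseudoMetricSpace (c₂ t) (c₁ t) p).trans (hup _ ht₂ _ ht₁)
  simpa using hdiff.add hL
end

section
/- Let M be a set equipped with two metrics d and ρ such that: (i) every continuous path [a,b] → (M,d) is also continuous as a map into (M,ρ); and (ii) for every p ∈ M there exist a ρ-neighborhood V of p and constants 0 < c ≤ C with c·ρ(x,y) ≤ d(x,y) ≤ C·ρ(x,y) for all x,y ∈ V. Then the topology induced by the intrinsic metric \hat d is finer than the topology induced by ρ: for every p ∈ M and ε > 0 there exists δ > 0 such that the \hat d-ball B_{\hat d}(p,δ) is contained in the ρ-ball B_ρ(p,ε). -/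
open scoped ENNReal

/-- The length (total variation) of `γ` over `[a,b]`, with respect to the metric `d`. -/
noncomputable def pathLength {M : Type*} (d : MetricSpace M) (γ : ℝ → M) (a b : ℝ) : ℝ≥0∞ :=
  @eVariationOn ℝ _ M (@PseudoMetricSpace.toPseudoEMetricSpace M d.toPseudoMetricSpace)
    γ (Set.Icc a b)

/-- The intrinsic (inner) metric induced by `d`: the infimum of lengths of continuous
paths joining `x` to `y`, with values in `[0,∞]`. -/
noncomputable def intrinsicDist {M : Type*} (d : MetricSpace M) (x y : M) : ℝ≥0∞ :=
  ⨅ (γ : ℝ → M) (a : ℝ) (b : ℝ) (_ : a ≤ b) (_ : γ a = x) (_ : γ b = y)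
    (_ : @ContinuousOn ℝ M _ d.toUniformSpace.toTopologicalSpace γ (Set.Icc a b)),
    pathLength d γ a b

/-- Let `d`, `ρ` be metrics on `M` such that (i) every `d`-continuous path
is `ρ`-continuous, and (ii) around every point, `d` and `ρ` are Lipschitz equivalent on a
`ρ`-neighborhood.  Then the topology of the intrinsic metric `\hat d` is finer than the one
induced by `ρ`: every `ρ`-ball around `p` contains a `\hat d`-ball around `p`. -/
theorem stmt17 {M : Type*} (d ρ : MetricSpace M)
    (hpaths : ∀ (a b : ℝ) (γ : ℝ → M),
      @ContinuousOn ℝ M _ d.toUniformSpace.toTopologicalSpace γ (Set.Icc a b) →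
      @ContinuousOn ℝ M _ ρ.toUniformSpace.toTopologicalSpace γ (Set.Icc a b))
    (hlip : ∀ p : M, ∃ V ∈ @nhds M ρ.toUniformSpace.toTopologicalSpace p, ∃ c C : ℝ,
      0 < c ∧ c ≤ C ∧ ∀ x ∈ V, ∀ y ∈ V,
        c * ρ.dist x y ≤ d.dist x y ∧ d.dist x y ≤ C * ρ.dist x y) :
    ∀ p : M, ∀ ε : ℝ, 0 < ε → ∃ δ : ℝ≥0∞, 0 < δ ∧
      ∀ y : M, intrinsicDist d p y < δ → ρ.dist p y < ε := by
  intro p ε hε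
  obtain ⟨V, hV, c, C, hc, -, hVc⟩ := hlip p
  obtain ⟨r, hr, hrV⟩ := (@Metric.mem_nhds_iff M ρ.toPseudoMetricSpace p V).1 hV
  have hs : 0 < min (r / 2) ε := lt_min (half_pos hr) hε
  have hsr : min (r / 2) ε < r := (min_le_left _ _).trans_lt (half_lt_self hr)
  refine ⟨ENNReal.ofReal (c * min (r / 2) ε), ENNReal.ofReal_pos.2 (mul_pos hc hs), ?_⟩
  intro y hy
  by_contra! hεy
  simp only [intrinsicDist, iInf_lt_iff] at hy
  obtain ⟨γ, a, b, hab, rfl, rfl, hγ, hlen⟩ := hy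
  have hf : ContinuousOn (fun t => ρ.dist (γ a) (γ t)) (Set.Icc a b) :=
    let _ := ρ
    (continuous_const.dist continuous_id).comp_continuousOn (hpaths a b γ hγ)
  have hpp : ρ.dist (γ a) (γ a) = 0 := ρ.dist_self _
  obtain ⟨t, ht, hts⟩ := intermediate_value_Icc hab hf
    (show min (r / 2) ε ∈ _ from ⟨hpp.trans_le hs.le, (min_le_right _ _).trans hεy⟩)
  have hpV : γ a ∈ V := hrV (@Metric.mem_ball_self M ρ.toPseudoMetricSpace _ _ hr)
  have htV : γ t ∈ V := hrV <| (@Metric.mem_ball' M ρ.toPseudoMetricSpace _ _ _).2 <|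
    (show ρ.dist (γ a) (γ t) < r from hts.trans_lt hsr)
  have hdt : c * min (r / 2) ε ≤ d.dist (γ a) (γ t) := by
    have := (hVc _ hpV _ htV).1
    rwa [show ρ.dist (γ a) (γ t) = min (r / 2) ε from hts] at this
  refine hlen.not_ge ((ENNReal.ofReal_le_ofReal hdt).trans ?_)
  let _ := d
  exact (edist_dist (γ a) (γ t)).symm.trans_le
    (eVariationOn.edist_le γ (Set.left_mem_Icc.2 hab) ht)
end
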